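/- arXiv:1303.2996 — 3 statements merged into one kernel-verified Lean document; each statement's English description precedes it below -/
import Mathlib

section
/- Let F : ℂ → ℂ be a bounded measurable function. Suppose there exist N ∈ ℕ and entire functions f_1,…,f_N, g_1,…,g_N : ℂ → ℂ with ∫_ℂ |f_j(w)|² e^{−|w|²} dλ(w) < ∞ and ∫_ℂ |g_j(w)|² e^{−|w|²} dλ(w) < ∞ for each j, such that for all z, z' ∈ ℂ: (1/π) ∫_ℂ F(w) e^{w·conj(z) + conj(w)·z'} e^{−|w|²} dλ(w) = Σ_{j=1}^N conj(g_j(z)) · f_j(z'). Then F = 0 almost everywhere on ℂ. -/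
open MeasureTheory Complex Filter

open scoped Topology FourierTransform ComplexConjugate

/-- Linearly independent functions are separated by some choice of equally many points. -/
lemma LinearIndependent.exists_det_eval_ne_zero {K X : Type*} [Field K] {n : ℕ}
    {u : Fin n → X → K} (hu : LinearIndependent K u) :
    ∃ x : Fin n → X, (Matrix.of fun i j => u j (x i)).det ≠ 0 := by
  set v : X → Fin n → K := fun x j => u j x with hv
  have hspan : Submodule.span K (Set.range v) = ⊤ := by
    by_contra hne
    obtain ⟨φ, hφ, hle⟩ := Submodule.exists_le_ker_of_lt_top _ (lt_top_iff_ne_top.2 hne)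
    refine hφ (LinearMap.pi_ext' fun j => LinearMap.ext_ring ?_)
    have hsum : ∑ j, φ (Pi.single j 1) • u j = 0 := by
      funext x
      have hx : φ (v x) = 0 := hle (Submodule.subset_span ⟨x, rfl⟩)
      rw [pi_eq_sum_univ' (v x), map_sum] at hx
      simpa [hv, mul_comm] using hx
    simpa using Fintype.linearIndependent_iff.1 hu _ hsum j
  have hrank : Module.finrank K (Submodule.span K (Set.range v)) = n := by
    rw [hspan, finrank_top, Module.finrank_fin_fun]
  obtain ⟨f, hf, hli⟩ : ∃ f : Fin n → Fin n → K, (∀ i, f i ∈ Set.range v) ∧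
      LinearIndependent K f := by
    have h := Submodule.exists_fun_fin_finrank_span_eq K (Set.range v)
    rw [hrank] at h
    exact h.imp fun f hf => ⟨hf.1, hf.2.2⟩
  choose x hx using hf
  refine ⟨x, ?_⟩
  have hrow : (Matrix.of fun i j => u j (x i)).row = f := funext hx
  rw [← isUnit_iff_ne_zero, ← Matrix.isUnit_iff_isUnit_det,
    ← Matrix.linearIndependent_rows_iff_isUnit, hrow]
  exact hli

/-- A dependent family of first factors allows one to drop a term from a sum of products. -/
lemma exists_sum_mul_eq_of_not_linearIndependent {K X Y : Type*} [Field K]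
    (U : Submodule K (X → K)) (V : Submodule K (Y → K)) {n : ℕ}
    {u : Fin (n + 1) → X → K} {v : Fin (n + 1) → Y → K}
    (hu : ∀ j, u j ∈ U) (hv : ∀ j, v j ∈ V) (hdep : ¬ LinearIndependent K u) :
    ∃ (u' : Fin n → X → K) (v' : Fin n → Y → K), (∀ j, u' j ∈ U) ∧ (∀ j, v' j ∈ V) ∧
      ∀ x y, ∑ j, u' j x * v' j y = ∑ j, u j x * v j y := by
  obtain ⟨c, hc, i, hi⟩ := Fintype.not_linearIndependent_iff.1 hdep
  refine ⟨fun k => u (i.succAbove k),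
    fun k => v (i.succAbove k) - (c (i.succAbove k) / c i) • v i, fun k => hu _,
    fun k => V.sub_mem (hv _) (V.smul_mem _ (hv _)), fun x y => ?_⟩
  have hx := congrFun hc x
  simp only [Finset.sum_apply, Pi.smul_apply, smul_eq_mul, Pi.zero_apply] at hx
  rw [Fin.sum_univ_succAbove _ i] at hx ⊢
  have hsolve : u i x = -∑ k, c (i.succAbove k) / c i * u (i.succAbove k) x := by
    apply mul_left_cancel₀ hi
    rw [mul_neg, Finset.mul_sum, eq_neg_of_add_eq_zero_left hx]
    congr 1
    refine Finset.sum_congr rfl fun k _ => ?_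
    field_simp
  rw [hsolve, neg_mul, Finset.sum_mul, ← Finset.sum_neg_distrib, ← Finset.sum_add_distrib]
  refine Finset.sum_congr rfl fun k _ => ?_
  simp only [Pi.sub_apply, Pi.smul_apply, smul_eq_mul]
  ring

/-- A finite sum of products of functions can be rewritten so that both families of factors
are linearly independent. -/
lemma exists_linearIndependent_sum_mul_eq {K X Y : Type*} [Field K]
    (U : Submodule K (X → K)) (V : Submodule K (Y → K)) (n : ℕ)
    (u : Fin n → X → K) (v : Fin n → Y → K) (hu : ∀ j, u j ∈ U) (hv : ∀ j, v j ∈ V) :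
    ∃ (m : ℕ) (u' : Fin m → X → K) (v' : Fin m → Y → K), (∀ j, u' j ∈ U) ∧ (∀ j, v' j ∈ V) ∧
      LinearIndependent K u' ∧ LinearIndependent K v' ∧
      ∀ x y, ∑ j, u' j x * v' j y = ∑ j, u j x * v j y := by
  induction n with
  | zero => exact ⟨0, u, v, hu, hv, linearIndependent_empty_type, linearIndependent_empty_type,
      fun _ _ => rfl⟩
  | succ n ih =>
    by_cases hlu : LinearIndependent K u
    · by_cases hlv : LinearIndependent K v
      · exact ⟨n + 1, u, v, hu, hv, hlu, hlv, fun _ _ => rfl⟩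
      · obtain ⟨v₁, u₁, hv₁, hu₁, h₁⟩ :=
          exists_sum_mul_eq_of_not_linearIndependent V U hv hu hlv
        obtain ⟨m, u', v', hu', hv', hlu', hlv', h'⟩ := ih u₁ v₁ hu₁ hv₁
        refine ⟨m, u', v', hu', hv', hlu', hlv', fun x y => ?_⟩
        rw [h', Finset.sum_congr rfl fun j _ => mul_comm (u₁ j x) (v₁ j y), h₁]
        exact Finset.sum_congr rfl fun j _ => mul_comm _ _
    · obtain ⟨u₁, v₁, hu₁, hv₁, h₁⟩ :=
        exists_sum_mul_eq_of_not_linearIndependent U V hu hv hlu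
      obtain ⟨m, u', v', hu', hv', hlu', hlv', h'⟩ := ih u₁ v₁ hu₁ hv₁
      exact ⟨m, u', v', hu', hv', hlu', hlv', fun x y => (h' x y).trans (h₁ x y)⟩

/-- The space of entire functions. -/
def entireFunctions : Submodule ℂ (ℂ → ℂ) where
  carrier := {f | Differentiable ℂ f}
  add_mem' := fun hf hg => Differentiable.add hf hg
  zero_mem' := differentiable_const 0
  smul_mem' := fun c _ hf => Differentiable.const_smul hf c

lemma Differentiable.conj_comp_conj {f : ℂ → ℂ} (hf : Differentiable ℂ f) :
    Differentiable ℂ fun z => conj (f (conj z)) := fun z =>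
  differentiableAt_conj_conj_iff.2 (hf (conj z))

lemma Differentiable.det {n : ℕ} {A : ℂ → Matrix (Fin n) (Fin n) ℂ}
    (hA : ∀ i j, Differentiable ℂ fun z => A z i j) : Differentiable ℂ fun z => (A z).det := by
  simp only [Matrix.det_apply]
  fun_prop

/-- If all translates of `∑ u j (conj z) * v j (-z)` vanish at infinity, for linearly independent
families `u`, `v` of entire functions, then the sum is empty. -/
lemma eq_zero_of_tendsto_sum_mul_conj {n : ℕ} {u v : Fin n → ℂ → ℂ}
    (hu : ∀ j, Differentiable ℂ (u j)) (hv : ∀ j, Differentiable ℂ (v j))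
    (hlu : LinearIndependent ℂ u) (hlv : LinearIndependent ℂ v)
    (h : ∀ a b, Tendsto (fun z => ∑ j, u j (conj z + a) * v j (-z + b)) (cocompact ℂ) (𝓝 0)) :
    n = 0 := by
  by_contra hn
  have : Nonempty (Fin n) := Fin.pos_iff_nonempty.1 (Nat.pos_of_ne_zero hn)
  obtain ⟨a, ha⟩ := hlu.exists_det_eval_ne_zero
  obtain ⟨b, hb⟩ := hlv.exists_det_eval_ne_zero
  set A : ℂ → Matrix (Fin n) (Fin n) ℂ := fun z => .of fun i j => u j (z + a i) with hA
  set B : ℂ → Matrix (Fin n) (Fin n) ℂ := fun z => .of fun i j => v j (-z + b i) with hB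
  have hdiff : Differentiable ℂ fun z => conj (A (conj z)).det * (B z).det := by
    refine Differentiable.mul (Differentiable.conj_comp_conj (f := fun z => (A z).det)
      (Differentiable.det fun i j => ?_)) (Differentiable.det fun i j => ?_)
    · exact (hu j).comp (by fun_prop)
    · exact (hv j).comp (by fun_prop)
  have hlim : Tendsto (fun z => A (conj z) * (B z).transpose) (cocompact ℂ) (𝓝 0) := by
    refine tendsto_pi_nhds.2 fun i => tendsto_pi_nhds.2 fun j => ?_
    simpa [hA, hB, Matrix.mul_apply] using h (a i) (b j)
  have hdet : Tendsto (fun z => conj (A (conj z)).det * (B z).det) (cocompact ℂ) (𝓝 0) := by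
    have := ((continuous_id.matrix_det.tendsto _).comp hlim).norm
    rw [tendsto_zero_iff_norm_tendsto_zero]
    simpa [Function.comp_def, Matrix.det_mul] using this
  have h0 := hdiff.apply_eq_of_tendsto_cocompact 0 hdet
  simp [hA, hB, ha, hb] at h0

/-- An integrable function whose Fourier transform vanishes identically is zero almost
everywhere. -/
lemma MeasureTheory.Integrable.ae_eq_zero_of_fourier_eq_zero {V : Type*} [NormedAddCommGroup V]
    [InnerProductSpace ℝ V] [FiniteDimensional ℝ V] [MeasurableSpace V] [BorelSpace V]
    {f : V → ℂ} (hf : Integrable f) (h : ∀ w, 𝓕 f w = 0) : f =ᵐ[volume] 0 := by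
  refine ae_eq_zero_of_integral_contDiff_smul_eq_zero hf.locallyIntegrable fun φ hφ hφc => ?_
  have hc : HasCompactSupport fun x => (φ x : ℂ) := hφc.comp_left ofReal_zero
  set ψ : SchwartzMap V ℂ := hc.toSchwartzMap (ofRealCLM.contDiff.comp hφ)
  have key := VectorFourier.integral_fourierIntegral_smul_eq_flip (L := innerₗ V)
    Real.continuous_fourierChar continuous_inner hf
    ((𝓕⁻ ψ : SchwartzMap V ℂ).integrable (μ := volume))
  have hl : ∀ w, VectorFourier.fourierIntegral 𝐞 volume (innerₗ V) f w = 0 := h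
  have hr : VectorFourier.fourierIntegral 𝐞 volume (innerₗ V).flip (𝓕⁻ ψ : SchwartzMap V ℂ)
      = (ψ : V → ℂ) := by
    rw [flip_innerₗ]
    change 𝓕 ((𝓕⁻ ψ : SchwartzMap V ℂ) : V → ℂ) = ψ
    rw [← SchwartzMap.fourier_coe, FourierTransform.fourier_fourierInv_eq]
  simp only [hl, hr, zero_smul, integral_zero] at key
  rw [key]
  refine integral_congr_ae (.of_forall fun x => ?_)
  have hψx : ψ x = φ x := rfl
  simp [hψx, mul_comm]

/-- The exponential kernel along the antidiagonal is a Fourier character. -/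
lemma exp_mul_conj_add_eq_fourierChar (w z a b : ℂ) :
    cexp (w * (conj z + a) + conj w * (-z + b)) =
      (𝐞 (-inner ℝ w (-(I / Real.pi) * z)) : ℂ) * cexp (w * a + conj w * b) := by
  rw [Real.fourierChar_apply, ← Complex.exp_add]
  congr 1
  apply Complex.ext
  · simp [Complex.inner, div_re, div_im, normSq_apply]
    field_simp
    ring
  · simp [Complex.inner, div_re, div_im, normSq_apply]
    field_simp
    ring

/-- The Gaussian-weighted exponential integral of a bounded function vanishes at infinity along
the antidiagonal. -/
lemma tendsto_integral_exp_gaussian_antidiagonal (F : ℂ → ℂ) (a b : ℂ) :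
    Tendsto (fun z => ∫ w : ℂ, F w * cexp (w * (conj z + a) + conj w * (-z + b)) *
      (Real.exp (-‖w‖ ^ 2) : ℂ)) (cocompact ℂ) (𝓝 0) := by
  have hc : -(I / (Real.pi : ℂ)) ≠ 0 := by simp [Real.pi_ne_zero]
  have h := (tendsto_integral_exp_inner_smul_cocompact fun w : ℂ =>
    F w * cexp (w * a + conj w * b) * (Real.exp (-‖w‖ ^ 2) : ℂ)).comp
      (Homeomorph.mulLeft₀ _ hc).isClosedEmbedding.tendsto_cocompact
  refine h.congr fun z => integral_congr_ae (.of_forall fun w => ?_)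
  simp only [Homeomorph.coe_mulLeft₀, Circle.smul_def, smul_eq_mul,
    exp_mul_conj_add_eq_fourierChar]
  ring

/-- A bounded function whose Gaussian-weighted exponential integrals vanish is zero. -/
lemma ae_eq_zero_of_integral_exp_gaussian_eq_zero {F : ℂ → ℂ} (hF : Measurable F)
    (hbd : ∃ C : ℝ, ∀ z, ‖F z‖ ≤ C)
    (h : ∀ z, ∫ w : ℂ, F w * cexp (w * conj z + conj w * (-z)) * (Real.exp (-‖w‖ ^ 2) : ℂ) = 0) :
    F =ᵐ[volume] 0 := by
  obtain ⟨C, hC⟩ := hbd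
  have hexp : Integrable fun w : ℂ => (Real.exp (-‖w‖ ^ 2) : ℂ) := by
    simpa using GaussianFourier.integrable_cexp_neg_mul_sq_norm_add (V := ℂ) (b := 1) (by simp) 0 0
  have hint : Integrable fun w : ℂ => F w * (Real.exp (-‖w‖ ^ 2) : ℂ) :=
    hexp.bdd_mul hF.aestronglyMeasurable (.of_forall hC)
  have hc : -(I / (Real.pi : ℂ)) ≠ 0 := by simp [Real.pi_ne_zero]
  have hzero := hint.ae_eq_zero_of_fourier_eq_zero fun ξ => by
    rw [Real.fourier_eq, ← h ((-(I / (Real.pi : ℂ)))⁻¹ * ξ)]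
    refine integral_congr_ae (.of_forall fun w => ?_)
    have hk := exp_mul_conj_add_eq_fourierChar w ((-(I / (Real.pi : ℂ)))⁻¹ * ξ) 0 0
    rw [mul_inv_cancel_left₀ hc] at hk
    simp only [add_zero, mul_zero, Complex.exp_zero, mul_one] at hk
    simp only [hk, Circle.smul_def, smul_eq_mul]
    ring
  filter_upwards [hzero] with w hw
  simpa [Real.exp_ne_zero] using hw

theorem finite_rank_theorem_bounded_symbol
    (F : ℂ → ℂ) (hFmeas : Measurable F) (hFbd : ∃ C : ℝ, ∀ z : ℂ, ‖F z‖ ≤ C)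
    (N : ℕ) (f g : Fin N → ℂ → ℂ)
    (hf : ∀ j, Differentiable ℂ (f j)) (hg : ∀ j, Differentiable ℂ (g j))
    (hfL2 : ∀ j, Integrable (fun w : ℂ => ‖f j w‖ ^ 2 * Real.exp (-‖w‖ ^ 2)))
    (hgL2 : ∀ j, Integrable (fun w : ℂ => ‖g j w‖ ^ 2 * Real.exp (-‖w‖ ^ 2)))
    (hform : ∀ z z' : ℂ,
      (1 / (Real.pi : ℂ)) * ∫ w : ℂ, F w *
          Complex.exp (w * (starRingEnd ℂ) z + (starRingEnd ℂ) w * z') *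
          (Real.exp (-‖w‖ ^ 2) : ℂ)
        = ∑ j, (starRingEnd ℂ) (g j z) * f j z') :
    F =ᵐ[volume] 0 := by
  obtain ⟨m, u, v, hu, hv, hlu, hlv, huv⟩ :=
    exists_linearIndependent_sum_mul_eq entireFunctions entireFunctions N
      (fun j z => conj (g j (conj z))) f (fun j => (hg j).conj_comp_conj) hf
  have hpi : (1 / (Real.pi : ℂ)) ≠ 0 := by simp [Real.pi_ne_zero]
  have hker : ∀ z z' : ℂ, ∑ j, u j z * v j z' = (1 / (Real.pi : ℂ)) * ∫ w : ℂ, F w *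
      cexp (w * z + conj w * z') * (Real.exp (-‖w‖ ^ 2) : ℂ) := fun z z' => by
    rw [huv, ← hform (conj z), Complex.conj_conj]
  obtain rfl : m = 0 := eq_zero_of_tendsto_sum_mul_conj hu hv hlu hlv fun a b => by
    simp only [hker]
    simpa using (tendsto_integral_exp_gaussian_antidiagonal F a b).const_mul (1 / (Real.pi : ℂ))
  refine ae_eq_zero_of_integral_exp_gaussian_eq_zero hFmeas hFbd fun z => ?_
  have hz := hker (conj z) (-z)
  rw [Fin.sum_univ_zero] at hz
  exact (mul_eq_zero.1 hz.symm).resolve_left hpi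
end

section
/- Let f : ℂ → ℂ be an entire function in the class 𝔇_{1,-}, i.e., for every a > 0 there is a constant C_a with |f(z)| ≤ C_a e^{|z|² − a|z|} for all z ∈ ℂ. Then for every z ∈ ℂ, the function w ↦ e^{z·conj(w)} f(w) e^{−|w|²} is integrable on ℂ and f(z) = (1/π) ∫_ℂ e^{z·conj(w)} f(w) e^{−|w|²} dλ(w). -/
open MeasureTheory Complex Filter

/-- A function belongs to the class `𝔇_{1,-}` if for every `a > 0` there is a
constant `C` with `|h z| ≤ C e^{|z|² - a|z|}` for all `z`. -/
def MemDOneMinus (h : ℂ → ℂ) : Prop :=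
  ∀ a : ℝ, 0 < a → ∃ C : ℝ, ∀ z : ℂ, ‖h z‖ ≤ C * Real.exp (‖z‖ ^ 2 - a * ‖z‖)

/-- An entire function averages to its value at the origin along every orbit of the unit circle. -/
theorem integral_comp_circleMap_mul {F : ℂ → ℂ} (hF : Differentiable ℂ F) (u : ℂ) :
    ∫ θ in Set.Ioc 0 (2 * Real.pi), F (circleMap 0 1 θ * u) = 2 * Real.pi * F 0 := by
  have hd : Differentiable ℂ fun ζ => F (ζ * u) := by fun_prop
  have h := DiffContOnCl.circleAverage (f := fun ζ => F (ζ * u)) (c := 0) (R := 1)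
    hd.diffContOnCl
  rw [Real.circleAverage_def, intervalIntegral.integral_of_le Real.two_pi_pos.le, zero_mul] at h
  have hpi : (2 * Real.pi : ℂ) ≠ 0 := mod_cast Real.two_pi_pos.ne'
  rw [← h, Complex.real_smul]
  push_cast
  rw [mul_inv_cancel_left₀ hpi]

/-- Lebesgue measure on `ℂ` is invariant under multiplication by a point of the unit circle. -/
theorem integral_comp_circleMap_mul_left (G : ℂ → ℂ) (θ : ℝ) :
    ∫ u : ℂ, G (circleMap 0 1 θ * u) = ∫ u : ℂ, G u := by
  have h := (rotation (Circle.exp θ)).measurePreserving.integral_comp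
    (rotation (Circle.exp θ)).toHomeomorph.measurableEmbedding G
  simpa [circleMap] using h

/-- The mean value property with respect to a radial weight. -/
theorem integral_mul_radial {F : ℂ → ℂ} (hF : Differentiable ℂ F) {ρ g : ℝ → ℝ}
    (hρ : Continuous ρ) (hg : Integrable fun u : ℂ => g ‖u‖)
    (hb : ∀ u : ℂ, ‖F u * ρ ‖u‖‖ ≤ g ‖u‖) :
    ∫ u : ℂ, F u * ρ ‖u‖ = F 0 * (∫ u : ℂ, ρ ‖u‖ : ℝ) := by
  have hpi : (2 * Real.pi : ℂ) ≠ 0 := mod_cast Real.two_pi_pos.ne'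
  have hnorm (θ : ℝ) (u : ℂ) : ‖circleMap 0 1 θ * u‖ = ‖u‖ := by simp
  have hint : Integrable
      (Function.uncurry fun (θ : ℝ) (u : ℂ) => F (circleMap 0 1 θ * u) * ρ ‖u‖)
      ((volume.restrict (Set.Ioc 0 (2 * Real.pi))).prod volume) := by
    refine (hg.comp_snd (volume.restrict (Set.Ioc 0 (2 * Real.pi)))).mono' ?_
      (.of_forall fun p => ?_)
    · have := hF.continuous
      refine Continuous.aestronglyMeasurable ?_
      unfold Function.uncurry
      fun_prop
    · simpa only [Function.uncurry, hnorm] using hb (circleMap 0 1 p.1 * p.2)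
  have hswap := integral_integral_swap hint
  have hleft (θ : ℝ) : ∫ u : ℂ, F (circleMap 0 1 θ * u) * ρ ‖u‖ = ∫ u : ℂ, F u * ρ ‖u‖ := by
    simpa only [hnorm] using integral_comp_circleMap_mul_left (fun u => F u * ρ ‖u‖) θ
  simp_rw [hleft, integral_mul_const, integral_comp_circleMap_mul hF, integral_const_mul,
    integral_complex_ofReal] at hswap
  rw [integral_const, measureReal_restrict_apply_univ, Real.volume_real_Ioc_of_le
    Real.two_pi_pos.le, sub_zero, Complex.real_smul] at hswap
  push_cast at hswap
  exact mul_left_cancel₀ hpi (hswap.trans (mul_assoc _ _ _))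

theorem integrable_exp_neg_norm : Integrable fun u : ℂ => Real.exp (-‖u‖) := by
  refine .of_integral_ne_zero ?_
  have h := Complex.integral_exp_neg_rpow le_rfl
  simp only [Real.rpow_one] at h
  rw [h]
  have : 0 < Real.Gamma (2 / 1 + 1) := Real.Gamma_pos_of_pos (by norm_num)
  positivity

theorem integral_exp_neg_norm_sq : ∫ u : ℂ, Real.exp (-‖u‖ ^ 2) = Real.pi := by
  have h := Complex.integral_exp_neg_rpow one_le_two
  simp only [Real.rpow_two] at h
  rw [h]
  norm_num

/-- The integrand of the Fock reproducing formula decays exponentially. -/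
theorem MemDOneMinus.exists_bound {f : ℂ → ℂ} (hf : MemDOneMinus f) (z : ℂ) :
    ∃ C : ℝ, 0 ≤ C ∧ ∀ w : ℂ,
      ‖Complex.exp (z * (starRingEnd ℂ) w) * f w * (Real.exp (-‖w‖ ^ 2) : ℂ)‖ ≤
        C * Real.exp (-‖w‖) := by
  obtain ⟨C, hC⟩ := hf (‖z‖ + 1) (by positivity)
  have hC0 : 0 ≤ C := by
    have h := (norm_nonneg _).trans (hC 0)
    simpa using h
  refine ⟨C, hC0, fun w => ?_⟩
  have hexp : ‖Complex.exp (z * (starRingEnd ℂ) w)‖ ≤ Real.exp (‖z‖ * ‖w‖) := by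
    rw [Complex.norm_exp, Real.exp_le_exp]
    simpa using Complex.re_le_norm (z * (starRingEnd ℂ) w)
  rw [norm_mul, norm_mul, Complex.norm_real, Real.norm_of_nonneg (Real.exp_pos _).le]
  calc _ ≤ Real.exp (‖z‖ * ‖w‖) * (C * Real.exp (‖w‖ ^ 2 - (‖z‖ + 1) * ‖w‖)) *
        Real.exp (-‖w‖ ^ 2) := by gcongr; exact hC w
    _ = C * (Real.exp (‖z‖ * ‖w‖) * Real.exp (‖w‖ ^ 2 - (‖z‖ + 1) * ‖w‖) *
        Real.exp (-‖w‖ ^ 2)) := by ring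
    _ = C * Real.exp (-‖w‖) := by
      rw [← Real.exp_add, ← Real.exp_add]
      ring_nf

/-- Translating the Fock integrand by `z` turns the kernel into an entire factor. -/
theorem fock_integrand_add (f : ℂ → ℂ) (z u : ℂ) :
    Complex.exp (z * (starRingEnd ℂ) (u + z)) * f (u + z) * (Real.exp (-‖u + z‖ ^ 2) : ℂ) =
      f (u + z) * Complex.exp (-(u * (starRingEnd ℂ) z)) * (Real.exp (-‖u‖ ^ 2) : ℂ) := by
  have h : Complex.exp (z * (starRingEnd ℂ) (u + z)) * (Real.exp (-‖u + z‖ ^ 2) : ℂ) =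
      Complex.exp (-(u * (starRingEnd ℂ) z)) * (Real.exp (-‖u‖ ^ 2) : ℂ) := by
    push_cast
    rw [← Complex.exp_add, ← Complex.exp_add, ← Complex.mul_conj', ← Complex.mul_conj', map_add]
    ring_nf
  linear_combination f (u + z) * h

theorem fock_reproducing_property_extended
    (f : ℂ → ℂ) (hf : Differentiable ℂ f) (hfD : MemDOneMinus f) :
    ∀ z : ℂ,
      Integrable (fun w : ℂ =>
        Complex.exp (z * (starRingEnd ℂ) w) * f w * (Real.exp (-‖w‖ ^ 2) : ℂ)) ∧
      f z = (1 / (Real.pi : ℂ)) * ∫ w : ℂ,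
        Complex.exp (z * (starRingEnd ℂ) w) * f w * (Real.exp (-‖w‖ ^ 2) : ℂ) := by
  intro z
  obtain ⟨C, hC0, hC⟩ := hfD.exists_bound z
  constructor
  · refine (integrable_exp_neg_norm.const_mul C).mono' ?_ (.of_forall hC)
    have := hf.continuous
    exact Continuous.aestronglyMeasurable (by fun_prop)
  · have hF : Differentiable ℂ fun u =>
        f (u + z) * Complex.exp (-(u * (starRingEnd ℂ) z)) := by fun_prop
    have hmean := integral_mul_radial hF (ρ := fun r => Real.exp (-r ^ 2))
      (g := fun r => C * Real.exp ‖z‖ * Real.exp (-r)) (by fun_prop)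
      (integrable_exp_neg_norm.const_mul _) fun u => by
        rw [← fock_integrand_add]
        refine (hC (u + z)).trans ?_
        rw [mul_assoc, ← Real.exp_add]
        gcongr
        have := norm_sub_le (u + z) z
        rw [add_sub_cancel_right] at this
        linarith
    have hpi : (Real.pi : ℂ) ≠ 0 := ofReal_ne_zero.2 Real.pi_ne_zero
    rw [← integral_add_right_eq_self _ z]
    simp_rw [fock_integrand_add]
    rw [hmean, integral_exp_neg_norm_sq]
    simp only [zero_add, zero_mul, neg_zero, Complex.exp_zero, mul_one]
    field_simp
end

section
/- Let F : ℂ → ℂ be a measurable function in the class 𝔇_{1,-}, and suppose there exist N ∈ ℕ and entire functions f_1,…,f_N, g_1,…,g_N : ℂ → ℂ in 𝔇_{1,-} such that for all z, z' ∈ ℂ: (1/π) ∫_ℂ F(w) e^{w·conj(z) + conj(w)·z'} e^{−|w|²} dλ(w) = Σ_{j=1}^N conj(g_j(z)) f_j(z'). Then for every α, β ∈ ℕ, the function z ↦ Σ_{j=1}^N f_j^{(α)}(−iz) · conj(g_j^{(β)}(iz)) tends to 0 as |z| → ∞, where f^{(α)} denotes the α-th complex derivative. -/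
open MeasureTheory Complex Filter

/-- Measurable functions on `ℂ` decaying faster than `e^{-a|w|}` for every `a > 0`. -/
def HasSuperexpDecay (H : ℂ → ℂ) : Prop :=
  Measurable H ∧ ∀ a : ℝ, 0 < a → ∃ C : ℝ, ∀ w : ℂ, ‖H w‖ ≤ C * Real.exp (-(a * ‖w‖))

theorem integrable_exp_neg_mul_norm {a : ℝ} (ha : 3 ≤ a) :
    Integrable (fun w : ℂ => Real.exp (-(a * ‖w‖))) := by
  have h : Integrable (fun w : ℂ => (1 + ‖w‖) ^ (-(3 : ℝ))) :=
    integrable_one_add_norm (by rw [Complex.finrank_real_complex]; norm_num)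
  refine h.mono' (by fun_prop) (ae_of_all _ fun w => ?_)
  have h0 : 0 ≤ ‖w‖ := norm_nonneg w
  have h1 : (1 + ‖w‖) ^ (3 : ℝ) ≤ Real.exp (a * ‖w‖) := by
    calc (1 + ‖w‖) ^ (3 : ℝ) ≤ Real.exp ‖w‖ ^ (3 : ℝ) := by
          gcongr
          linarith [Real.add_one_le_exp ‖w‖]
      _ = Real.exp (‖w‖ * 3) := (Real.exp_mul _ _).symm
      _ ≤ Real.exp (a * ‖w‖) := by
          rw [mul_comm]
          gcongr
  rw [Real.norm_of_nonneg (Real.exp_pos _).le, Real.exp_neg, Real.rpow_neg (by positivity)]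
  gcongr

namespace HasSuperexpDecay

variable {H : ℂ → ℂ}

theorem integrable (hH : HasSuperexpDecay H) : Integrable H := by
  obtain ⟨C, hC⟩ := hH.2 3 (by norm_num)
  exact ((integrable_exp_neg_mul_norm le_rfl).const_mul C).mono' hH.1.aestronglyMeasurable
    (ae_of_all _ hC)

theorem mul_of_norm_le (hH : HasSuperexpDecay H) {u : ℂ → ℂ} (hu : Measurable u) {b : ℝ}
    (hb : 0 ≤ b) (hub : ∀ w, ‖u w‖ ≤ Real.exp (b * ‖w‖)) :
    HasSuperexpDecay (fun w => H w * u w) := by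
  refine ⟨hH.1.mul hu, fun a ha => ?_⟩
  obtain ⟨C, hC⟩ := hH.2 (a + b) (by linarith)
  refine ⟨C, fun w => ?_⟩
  calc ‖H w * u w‖ = ‖H w‖ * ‖u w‖ := norm_mul _ _
    _ ≤ (C * Real.exp (-((a + b) * ‖w‖))) * Real.exp (b * ‖w‖) :=
        mul_le_mul (hC w) (hub w) (norm_nonneg _) ((norm_nonneg _).trans (hC w))
    _ = C * Real.exp (-(a * ‖w‖)) := by
        rw [mul_assoc, ← Real.exp_add]
        ring_nf

theorem mul_cexp (hH : HasSuperexpDecay H) {u : ℂ → ℂ} (hu : Measurable u)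
    (hu' : ∀ w, ‖u w‖ ≤ ‖w‖) (z : ℂ) :
    HasSuperexpDecay (fun w => H w * Complex.exp (u w * z)) := by
  refine hH.mul_of_norm_le (by fun_prop) (norm_nonneg z) fun w => ?_
  rw [Complex.norm_exp]
  gcongr
  calc (u w * z).re ≤ ‖u w * z‖ := Complex.re_le_norm _
    _ = ‖z‖ * ‖u w‖ := by rw [norm_mul, mul_comm]
    _ ≤ ‖z‖ * ‖w‖ := by gcongr; exact hu' w

theorem mul_star (hH : HasSuperexpDecay H) :
    HasSuperexpDecay (fun w => H w * (starRingEnd ℂ) w) := by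
  refine hH.mul_of_norm_le (Complex.continuous_conj.measurable) zero_le_one fun w => ?_
  rw [Complex.norm_conj, one_mul]
  linarith [Real.add_one_le_exp ‖w‖]

theorem mul_star_pow (hH : HasSuperexpDecay H) (n : ℕ) :
    HasSuperexpDecay (fun w => H w * (starRingEnd ℂ) w ^ n) := by
  induction n with
  | zero => simpa using hH
  | succ n ih => simpa only [pow_succ, mul_assoc] using ih.mul_star

theorem star (hH : HasSuperexpDecay H) : HasSuperexpDecay (fun w => (starRingEnd ℂ) (H w)) :=
  ⟨Complex.continuous_conj.measurable.comp hH.1, by simpa only [Complex.norm_conj] using hH.2⟩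

theorem hasDerivAt_integral (hH : HasSuperexpDecay H) (z : ℂ) :
    HasDerivAt (fun z => ∫ w, H w * Complex.exp ((starRingEnd ℂ) w * z))
      (∫ w, H w * (starRingEnd ℂ) w * Complex.exp ((starRingEnd ℂ) w * z)) z := by
  have hm : Measurable (starRingEnd ℂ) := Complex.continuous_conj.measurable
  have hn : ∀ w : ℂ, ‖(starRingEnd ℂ) w‖ ≤ ‖w‖ := fun w => (Complex.norm_conj w).le
  obtain ⟨C, hC⟩ := hH.mul_star.2 (3 + (‖z‖ + 1)) (by positivity)
  refine (hasDerivAt_integral_of_dominated_loc_of_deriv_le (s := Metric.ball z 1)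
    (F' := fun z w => H w * (starRingEnd ℂ) w * Complex.exp ((starRingEnd ℂ) w * z))
    (bound := fun w => C * Real.exp (-(3 * ‖w‖))) (Metric.ball_mem_nhds z one_pos)
    (Eventually.of_forall fun y => (hH.mul_cexp hm hn y).1.aestronglyMeasurable)
    (hH.mul_cexp hm hn z).integrable (hH.mul_star.mul_cexp hm hn z).1.aestronglyMeasurable
    (ae_of_all _ fun w y hy => ?_) ((integrable_exp_neg_mul_norm le_rfl).const_mul C)
    (ae_of_all _ fun w y _ => ?_)).2
  · have hy' : ‖y‖ ≤ ‖z‖ + 1 := by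
      have h1 : ‖y - z‖ < 1 := mem_ball_iff_norm.1 hy
      linarith [norm_sub_norm_le y z]
    have he : ‖Complex.exp ((starRingEnd ℂ) w * y)‖ ≤ Real.exp ((‖z‖ + 1) * ‖w‖) := by
      rw [Complex.norm_exp]
      gcongr
      calc ((starRingEnd ℂ) w * y).re ≤ ‖(starRingEnd ℂ) w * y‖ := Complex.re_le_norm _
        _ = ‖y‖ * ‖w‖ := by rw [norm_mul, mul_comm, Complex.norm_conj]
        _ ≤ (‖z‖ + 1) * ‖w‖ := by gcongr
    calc _ = ‖H w * (starRingEnd ℂ) w‖ * ‖Complex.exp ((starRingEnd ℂ) w * y)‖ := norm_mul _ _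
      _ ≤ (C * Real.exp (-((3 + (‖z‖ + 1)) * ‖w‖))) * Real.exp ((‖z‖ + 1) * ‖w‖) :=
          mul_le_mul (hC w) he (norm_nonneg _) ((norm_nonneg _).trans (hC w))
      _ = C * Real.exp (-(3 * ‖w‖)) := by
          rw [mul_assoc, ← Real.exp_add]
          ring_nf
  · have h := (((hasDerivAt_id y).const_mul ((starRingEnd ℂ) w)).cexp).const_mul (H w)
    refine h.congr_deriv ?_
    simp only [id]
    ring

theorem iteratedDeriv_integral (hH : HasSuperexpDecay H) (n : ℕ) :
    iteratedDeriv n (fun z => ∫ w, H w * Complex.exp ((starRingEnd ℂ) w * z)) =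
      fun z => ∫ w, H w * (starRingEnd ℂ) w ^ n * Complex.exp ((starRingEnd ℂ) w * z) := by
  induction n with
  | zero => simp
  | succ n ih =>
    rw [iteratedDeriv_succ, ih]
    funext z
    simpa only [pow_succ, mul_assoc] using ((hH.mul_star_pow n).hasDerivAt_integral z).deriv

/-- Differentiating a representation of `∫ H(w) e^{conj(w) z}` as a finite sum of entire functions. -/
theorem integral_eq_sum_iteratedDeriv (hH : HasSuperexpDecay H) {ι : Type*} [Fintype ι]
    {c : ι → ℂ} {h : ι → ℂ → ℂ} (hh : ∀ j, Differentiable ℂ (h j))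
    (heq : ∀ z, ∫ w, H w * Complex.exp ((starRingEnd ℂ) w * z) = ∑ j, c j * h j z)
    (n : ℕ) (z : ℂ) :
    ∫ w, H w * (starRingEnd ℂ) w ^ n * Complex.exp ((starRingEnd ℂ) w * z) =
      ∑ j, c j * iteratedDeriv n (h j) z := by
  rw [← congrFun (hH.iteratedDeriv_integral n) z, funext heq,
    iteratedDeriv_fun_sum fun j _ => ((hh j).const_mul (c j)).contDiff.contDiffAt]
  simp

end HasSuperexpDecay

theorem MemDOneMinus.hasSuperexpDecay {F : ℂ → ℂ} (hF : MemDOneMinus F) (hm : Measurable F) :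
    HasSuperexpDecay (fun w => F w * (Real.exp (-‖w‖ ^ 2) : ℂ)) := by
  refine ⟨by fun_prop, fun a ha => ?_⟩
  obtain ⟨C, hC⟩ := hF a ha
  refine ⟨C, fun w => ?_⟩
  rw [norm_mul, Complex.norm_real, Real.norm_of_nonneg (Real.exp_pos _).le]
  calc ‖F w‖ * Real.exp (-‖w‖ ^ 2)
      ≤ C * Real.exp (‖w‖ ^ 2 - a * ‖w‖) * Real.exp (-‖w‖ ^ 2) := by gcongr; exact hC w
    _ = C * Real.exp (-(a * ‖w‖)) := by
        rw [mul_assoc, ← Real.exp_add]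
        ring_nf

/-- The Riemann–Lebesgue lemma on `ℂ`, with the pairing `w conj(z) + conj(w) z`. -/
theorem tendsto_integral_mul_cexp_neg_I_mul_cocompact (H : ℂ → ℂ) :
    Tendsto (fun z : ℂ => ∫ w, H w * Complex.exp
        (-(Complex.I * (w * (starRingEnd ℂ) z + (starRingEnd ℂ) w * z))))
      (cocompact ℂ) (nhds 0) := by
  have hpi : (Real.pi : ℂ)⁻¹ ≠ 0 := inv_ne_zero (Complex.ofReal_ne_zero.2 Real.pi_ne_zero)
  have h := (tendsto_integral_exp_inner_smul_cocompact H).comp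
    (Homeomorph.mulLeft₀ _ hpi).isClosedEmbedding.tendsto_cocompact
  refine h.congr fun z => integral_congr_ae (ae_of_all _ fun w => ?_)
  have hre : (w * (starRingEnd ℂ) z + (starRingEnd ℂ) w * z) =
      ((2 * (z * (starRingEnd ℂ) w).re : ℝ) : ℂ) := by
    rw [← Complex.add_conj, map_mul, Complex.conj_conj]
    ring
  have hin : inner ℝ w ((Homeomorph.mulLeft₀ _ hpi) z) =
      Real.pi⁻¹ * (z * (starRingEnd ℂ) w).re := by
    rw [Complex.inner, Homeomorph.coe_mulLeft₀, mul_assoc, ← Complex.ofReal_inv,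
      Complex.re_ofReal_mul]
  simp only [hin, hre, Circle.smul_def, Real.fourierChar_apply, smul_eq_mul]
  rw [mul_comm]
  congr 2
  push_cast
  field_simp

theorem finite_rank_implies_decay_of_derivative_sums
    (F : ℂ → ℂ) (hFmeas : Measurable F) (hF : MemDOneMinus F)
    (N : ℕ) (f g : Fin N → ℂ → ℂ)
    (hf : ∀ j, Differentiable ℂ (f j)) (hg : ∀ j, Differentiable ℂ (g j))
    (hfD : ∀ j, MemDOneMinus (f j)) (hgD : ∀ j, MemDOneMinus (g j))
    (hform : ∀ z z' : ℂ,
      (1 / (Real.pi : ℂ)) * ∫ w : ℂ, F w *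
          Complex.exp (w * (starRingEnd ℂ) z + (starRingEnd ℂ) w * z') *
          (Real.exp (-‖w‖ ^ 2) : ℂ)
        = ∑ j, (starRingEnd ℂ) (g j z) * f j z') :
    ∀ α β : ℕ,
      Tendsto (fun z : ℂ =>
          ∑ j, iteratedDeriv α (f j) (-(Complex.I * z)) *
            (starRingEnd ℂ) (iteratedDeriv β (g j) (Complex.I * z)))
        (cocompact ℂ) (nhds 0) := by
  intro α β
  have hG := hF.hasSuperexpDecay hFmeas
  have hm : Measurable (starRingEnd ℂ) := Complex.continuous_conj.measurable
  set G : ℂ → ℂ := fun w => F w * (Real.exp (-‖w‖ ^ 2) : ℂ) with hGdef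
  have hpi : (Real.pi : ℂ) ≠ 0 := Complex.ofReal_ne_zero.2 Real.pi_ne_zero
  have hGz : ∀ z : ℂ, HasSuperexpDecay
      (fun w => G w * Complex.exp (w * (starRingEnd ℂ) z)) :=
    fun z => hG.mul_cexp measurable_id (fun _ => le_rfl) _
  have hbase : ∀ z z' : ℂ,
      ∫ w, G w * Complex.exp (w * (starRingEnd ℂ) z) * Complex.exp ((starRingEnd ℂ) w * z') =
        ∑ j, (Real.pi * (starRingEnd ℂ) (g j z)) * f j z' := by
    intro z z'
    simp_rw [mul_assoc (Real.pi : ℂ), ← Finset.mul_sum, ← hform z z', ← mul_assoc,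
      mul_one_div_cancel hpi, one_mul]
    refine integral_congr_ae (ae_of_all _ fun w => ?_)
    simp only [hGdef, Complex.exp_add]
    ring
  have hα : ∀ z z' : ℂ,
      ∫ w, G w * Complex.exp (w * (starRingEnd ℂ) z) * (starRingEnd ℂ) w ^ α *
          Complex.exp ((starRingEnd ℂ) w * z') =
        ∑ j, (Real.pi * (starRingEnd ℂ) (g j z)) * iteratedDeriv α (f j) z' :=
    fun z => (hGz z).integral_eq_sum_iteratedDeriv hf (hbase z) α
  have hconj : ∀ z' z : ℂ,
      ∫ w, (starRingEnd ℂ) (G w * (starRingEnd ℂ) w ^ α * Complex.exp ((starRingEnd ℂ) w * z')) *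
          Complex.exp ((starRingEnd ℂ) w * z) =
        ∑ j, (Real.pi * (starRingEnd ℂ) (iteratedDeriv α (f j) z')) * g j z := by
    intro z' z
    have h := congrArg (starRingEnd ℂ) (hα z z')
    rw [← integral_conj, map_sum] at h
    refine Eq.trans (integral_congr_ae (ae_of_all _ fun w => ?_))
      (h.trans (Finset.sum_congr rfl fun j _ => ?_))
    · simp only [map_mul, map_pow, ← Complex.exp_conj, Complex.conj_conj]
      ring
    · simp only [map_mul, Complex.conj_conj, Complex.conj_ofReal]
      ring
  have hβ : ∀ z' z : ℂ, _ := fun z' =>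
    ((hG.mul_star_pow α).mul_cexp hm (fun w => (Complex.norm_conj w).le) z').star
      |>.integral_eq_sum_iteratedDeriv hg (hconj z') β
  have hlim := (tendsto_integral_mul_cexp_neg_I_mul_cocompact
    (fun w => G w * (starRingEnd ℂ) w ^ α * w ^ β)).const_mul (Real.pi : ℂ)⁻¹
  rw [mul_zero] at hlim
  refine hlim.congr fun z => ?_
  rw [inv_mul_eq_iff_eq_mul₀ hpi, Finset.mul_sum]
  have h := congrArg (starRingEnd ℂ) (hβ (-(Complex.I * z)) (Complex.I * z))
  rw [← integral_conj, map_sum] at h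
  refine Eq.trans (integral_congr_ae (ae_of_all _ fun w => ?_))
    (h.trans (Finset.sum_congr rfl fun j _ => ?_))
  · simp only [map_mul, map_pow, ← Complex.exp_conj, Complex.conj_conj, Complex.conj_I]
    rw [mul_right_comm _ (Complex.exp _) (w ^ β), mul_assoc _ (Complex.exp _) (Complex.exp _),
      ← Complex.exp_add]
    congr 2
    ring
  · simp only [map_mul, Complex.conj_conj, Complex.conj_ofReal]
    ring
end
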